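/- Assume in addition that A is positive definite. Let q ≥ 1 be a real number, let c ∈ (0,1), and set w := c·λ_min(A). Then the Lanczos-FA approximation of f(x) = x^{−q} satisfies ‖A^{−q} b − Q T^{−q} Qᴴ b‖₂ / ‖A^{−q} b‖₂ ≤ c^{−q} · κ(A)^q · κ(A − wI) · ‖err_k(w)‖₂ / ‖err₀(w)‖₂, where κ(B) := λ_max(B)/λ_min(B) for a positive definite matrix B, err₀(w) := (A − wI)⁻¹ b, and A^{−q}, T^{−q} are defined by raising the (positive) eigenvalues of A and T to the power −q in their spectral decompositions. -/

import Mathlib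

open Matrix MeasureTheory

/-- The Euclidean 2-norm of a complex vector. -/
noncomputable def norm2 {n : ℕ} (v : Fin n → ℂ) : ℝ :=
  Real.sqrt (∑ i, ‖v i‖ ^ 2)
open scoped ComplexOrder

/-- Apply a scalar function to a Hermitian matrix through its spectral decomposition. -/
noncomputable def matFun {m : ℕ} {B : Matrix (Fin m) (Fin m) ℂ}
    (hB : B.IsHermitian) (f : ℝ → ℂ) : Matrix (Fin m) (Fin m) ℂ :=
  (hB.eigenvectorUnitary : Matrix (Fin m) (Fin m) ℂ) *
    Matrix.diagonal (fun i => f (hB.eigenvalues i)) *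
    star (hB.eigenvectorUnitary : Matrix (Fin m) (Fin m) ℂ)

/-- The Lanczos-FA error for the shifted linear system `(A - z I) x = b`. -/
noncomputable def errK {n k : ℕ} (A : Matrix (Fin n) (Fin n) ℂ) (Q : Matrix (Fin n) (Fin k) ℂ)
    (T : Matrix (Fin k) (Fin k) ℂ) (b : Fin n → ℂ) (z : ℂ) : Fin n → ℂ :=
  (A - z • 1)⁻¹.mulVec b - (Q * (T - z • 1)⁻¹ * Qᴴ).mulVec b

/-- The Lanczos-FA residual for the shifted linear system `(A - z I) x = b`. -/
noncomputable def resK {n k : ℕ} (A : Matrix (Fin n) (Fin n) ℂ) (Q : Matrix (Fin n) (Fin k) ℂ)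
    (T : Matrix (Fin k) (Fin k) ℂ) (b : Fin n → ℂ) (z : ℂ) : Fin n → ℂ :=
  b - ((A - z • 1) * (Q * (T - z • 1)⁻¹ * Qᴴ)).mulVec b

/-- If `d` solves `d (j + 1) = s * d j + φ j * κ` with `φ ≥ 0` and `d 0 = 0`, then a power-type
series `∑ a j * d j` with `a ≥ 0` is controlled by the geometric series `∑ σ⁻¹ ^ (j + 1) * d j`. -/
lemma norm_le_of_linear_recurrence {d : ℕ → ℂ} {φ a : ℕ → ℝ} {κ X Y : ℂ} {s σ F : ℝ}
    (hφ : ∀ j, 0 ≤ φ j) (hs : 0 ≤ s) (hsσ : s < σ) (hd0 : d 0 = 0)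
    (hd : ∀ j, d (j + 1) = s * d j + φ j * κ) (ha : ∀ j, 0 ≤ a j)
    (hF : HasSum (fun j => a j * σ ^ j) F) (hX : HasSum (fun j => (a j : ℂ) * d j) X)
    (hY : HasSum (fun j => ((σ⁻¹ ^ (j + 1) : ℝ) : ℂ) * d j) Y) :
    ‖X‖ ≤ F * ((σ - s) * ‖Y‖) := by
  have hσ : 0 < σ := hs.trans_lt hsσ
  have hσc : (σ : ℂ) ≠ 0 := by exact_mod_cast hσ.ne'
  have hZ : HasSum (fun j => ((σ⁻¹ ^ (j + 1) * φ j : ℝ) : ℂ) * κ) ((σ - s : ℂ) * Y) := by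
    have h1 := ((hasSum_nat_add_iff' 1).mpr hY).mul_left (σ : ℂ)
    have h2 := h1.sub (hY.mul_left (s : ℂ))
    simp only [Finset.sum_range_one, hd0, mul_zero, sub_zero] at h2
    rw [sub_mul]
    refine h2.congr_fun ?_
    intro j
    rw [hd]
    push_cast
    have h3 : (σ : ℂ) * (σ : ℂ)⁻¹ ^ (j + 1 + 1) = (σ : ℂ)⁻¹ ^ (j + 1) := by
      rw [pow_succ', mul_inv_cancel_left₀ hσc]
    linear_combination (-(s * d j + φ j * κ)) * h3
  have hpart : ∀ j, (∑ m ∈ Finset.range j, σ⁻¹ ^ (m + 1) * φ m) * ‖κ‖ ≤ (σ - s) * ‖Y‖ := by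
    intro j
    by_cases hκ : κ = 0
    · simpa [hκ] using mul_nonneg (sub_nonneg.mpr hsσ.le) (norm_nonneg Y)
    have hre := Complex.hasSum_re (hZ.div_const κ)
    simp only [mul_div_cancel_right₀ _ hκ, Complex.ofReal_re] at hre
    have hle := sum_le_hasSum (Finset.range j) (fun m _ => by have := hφ m; positivity) hre
    have hnorm : ‖(σ - s : ℂ) * Y / κ‖ = (σ - s) * ‖Y‖ / ‖κ‖ := by
      rw [norm_div, norm_mul, ← Complex.ofReal_sub, Complex.norm_real, Real.norm_of_nonneg
        (sub_nonneg.mpr hsσ.le)]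
    have := hle.trans (Complex.re_le_norm _)
    rwa [hnorm, le_div_iff₀ (norm_pos_iff.mpr hκ)] at this
  have hdj : ∀ j, ‖d j‖ ≤ σ ^ j * ((∑ m ∈ Finset.range j, σ⁻¹ ^ (m + 1) * φ m) * ‖κ‖) := by
    intro j
    induction j with
    | zero => simp [hd0]
    | succ j ih =>
      rw [hd, Finset.sum_range_succ]
      calc ‖(s : ℂ) * d j + φ j * κ‖ ≤ s * ‖d j‖ + φ j * ‖κ‖ := by
            refine (norm_add_le _ _).trans_eq ?_
            simp [abs_of_nonneg hs, abs_of_nonneg (hφ j)]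
        _ ≤ σ * (σ ^ j * ((∑ m ∈ Finset.range j, σ⁻¹ ^ (m + 1) * φ m) * ‖κ‖)) + φ j * ‖κ‖ := by
            gcongr
        _ = _ := by
            have : σ ^ (j + 1) * σ⁻¹ ^ (j + 1) = 1 := by rw [← mul_pow, mul_inv_cancel₀ hσ.ne', one_pow]
            linear_combination (-(φ j * ‖κ‖)) * this
  rw [← hX.tsum_eq]
  refine tsum_of_norm_bounded (hF.mul_right _) fun j => ?_
  rw [norm_mul, Complex.norm_real, Real.norm_of_nonneg (ha j), mul_assoc]
  have := ha j
  gcongr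
  exact (hdj j).trans (mul_le_mul_of_nonneg_left (hpart j) (by positivity))

/-- The coefficients of `(1 - s) ^ (-p)` are nonnegative for `p > 0`. -/
lemma choose_add_sub_one_nonneg {p : ℝ} (hp : 0 < p) (j : ℕ) :
    0 ≤ Ring.choose (p + j - 1) j := by
  rw [← Ring.multichoose_eq]
  have h := Ring.factorial_nsmul_multichoose_eq_ascPochhammer p j
  rw [Polynomial.ascPochhammer_smeval_eq_eval, nsmul_eq_mul] at h
  have h1 := ascPochhammer_pos j p hp
  rw [← h] at h1
  exact (pos_of_mul_pos_right h1 (by positivity)).le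

lemma hasSum_rpow_neg {p M x : ℝ} (hM : 0 < M) (hx : 0 < x) (hxM : x ≤ M) :
    HasSum (fun j : ℕ => M ^ (-p) * Ring.choose (p + j - 1) j * (1 - x / M) ^ j) (x ^ (-p)) := by
  have hlt : 0 < x / M := by positivity
  have hle : x / M ≤ 1 := (div_le_one hM).mpr hxM
  have hball : 1 - x / M ∈ Metric.eball (0 : ℝ) 1 := by
    rw [← ENNReal.ofReal_one, Metric.eball_ofReal, mem_ball_zero_iff, Real.norm_eq_abs, abs_lt]
    constructor <;> linarith
  have h := ((Real.one_div_one_sub_rpow_hasFPowerSeriesOnBall_zero p).hasSum hball).mul_left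
    (M ^ (-p))
  have hval : x ^ (-p) = M ^ (-p) * (1 / (1 - (0 + (1 - x / M))) ^ p) := by
    rw [zero_add, sub_sub_cancel, Real.div_rpow hx.le hM.le, Real.rpow_neg hx.le,
      Real.rpow_neg hM.le]
    have := Real.rpow_pos_of_pos hM p
    field_simp
  rw [hval]
  refine h.congr_fun fun j => ?_
  simp [FormalMultilinearSeries.ofScalars, mul_assoc]

lemma hasSum_inv_sub {M x w : ℝ} (hM : 0 < M) (hwx : w < x) (hxM : x ≤ M) :
    HasSum (fun j : ℕ => M⁻¹ * (1 - w / M)⁻¹ ^ (j + 1) * (1 - x / M) ^ j) (x - w)⁻¹ := by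
  have h0 : 0 ≤ 1 - x / M := sub_nonneg.mpr ((div_le_one hM).mpr hxM)
  have h1 : 1 - x / M < 1 - w / M := by gcongr
  have h2 : 0 < 1 - w / M := h0.trans_lt h1
  have h := (hasSum_geometric_of_lt_one (div_nonneg h0 h2.le) ((div_lt_one h2).mpr h1)).mul_left
    (M⁻¹ * (1 - w / M)⁻¹)
  have hval : (x - w)⁻¹ = M⁻¹ * (1 - w / M)⁻¹ * (1 - (1 - x / M) / (1 - w / M))⁻¹ := by
    rw [one_sub_div h2.ne', inv_div, show (1 - w / M) - (1 - x / M) = (x - w) / M by ring]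
    have h3 : x - w ≠ 0 := by linarith
    have h4 : M - w ≠ 0 := by linarith
    rw [one_sub_div hM.ne']
    field_simp
  rw [hval]
  refine h.congr_fun fun j => ?_
  rw [div_pow, inv_pow, pow_succ]
  field_simp

section Norm

variable {n : ℕ}

lemma norm2_eq_norm_toLp (v : Fin n → ℂ) : norm2 v = ‖WithLp.toLp 2 v‖ := by
  rw [EuclideanSpace.norm_eq]
  rfl

lemma norm2_nonneg (v : Fin n → ℂ) : 0 ≤ norm2 v := Real.sqrt_nonneg _

lemma norm2_pos {v : Fin n → ℂ} (hv : v ≠ 0) : 0 < norm2 v := by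
  rw [norm2_eq_norm_toLp, norm_pos_iff]
  simpa using hv

lemma norm2_le_mul_of_forall_norm_le {v u : Fin n → ℂ} {C : ℝ} (hC : 0 ≤ C)
    (h : ∀ i, ‖v i‖ ≤ C * ‖u i‖) : norm2 v ≤ C * norm2 u := by
  refine Real.sqrt_le_iff.mpr ⟨mul_nonneg hC (norm2_nonneg u), ?_⟩
  rw [mul_pow, norm2, Real.sq_sqrt (by positivity), Finset.mul_sum]
  gcongr with i
  rw [← mul_pow]
  gcongr
  exact h i

lemma norm2_star_unitary_mulVec (U : Matrix.unitaryGroup (Fin n) ℂ) (v : Fin n → ℂ) :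
    norm2 ((star (U : Matrix (Fin n) (Fin n) ℂ)).mulVec v) = norm2 v := by
  have hsq : ∀ u : Fin n → ℂ, ((∑ i, ‖u i‖ ^ 2 : ℝ) : ℂ) = star u ⬝ᵥ u := by
    intro u
    simp [dotProduct, Complex.conj_mul']
  rw [norm2, norm2]
  congr 1
  apply Complex.ofReal_injective
  rw [hsq, hsq, star_mulVec, star_eq_conjTranspose, conjTranspose_conjTranspose,
    dotProduct_mulVec, vecMul_vecMul, ← star_eq_conjTranspose, Matrix.mem_unitaryGroup_iff.mp U.2,
    vecMul_one]

end Norm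

section MatFun

variable {m : ℕ} {B : Matrix (Fin m) (Fin m) ℂ} (hB : B.IsHermitian)

lemma star_eigenvectorUnitary_mulVec_matFun (f : ℝ → ℂ) (v : Fin m → ℂ) (i : Fin m) :
    (star (hB.eigenvectorUnitary : Matrix (Fin m) (Fin m) ℂ)).mulVec
        ((matFun hB f).mulVec v) i =
      f (hB.eigenvalues i) *
        (star (hB.eigenvectorUnitary : Matrix (Fin m) (Fin m) ℂ)).mulVec v i := by
  rw [matFun, mulVec_mulVec, ← mul_assoc, ← mul_assoc, Unitary.coe_star_mul_self, one_mul,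
    ← mulVec_mulVec, mulVec_diagonal]

lemma matFun_mul (f g : ℝ → ℂ) :
    matFun hB f * matFun hB g = matFun hB (fun x => f x * g x) := by
  simp only [matFun]
  rw [← diagonal_mul_diagonal]
  simp only [mul_assoc]
  rw [← mul_assoc (star _) (hB.eigenvectorUnitary : Matrix (Fin m) (Fin m) ℂ),
    Unitary.coe_star_mul_self, one_mul]

lemma matFun_const (z : ℂ) : matFun hB (fun _ => z) = z • 1 := by
  rw [matFun, ← smul_one_eq_diagonal]
  simp

lemma matFun_sub (f g : ℝ → ℂ) :
    matFun hB (fun x => f x - g x) = matFun hB f - matFun hB g := by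
  simp only [matFun]
  rw [← diagonal_sub, mul_sub, sub_mul]

lemma matFun_const_mul (z : ℂ) (f : ℝ → ℂ) :
    matFun hB (fun x => z * f x) = z • matFun hB f := by
  rw [← matFun_mul hB (fun _ => z), matFun_const, smul_mul_assoc, one_mul]

lemma matFun_ofReal : matFun hB (fun x => (x : ℂ)) = B := by
  conv_rhs => rw [hB.spectral_theorem]
  rfl

lemma matFun_congr {f g : ℝ → ℂ} (h : ∀ i, f (hB.eigenvalues i) = g (hB.eigenvalues i)) :
    matFun hB f = matFun hB g := by
  simp only [matFun, h]

lemma matFun_pow (f : ℝ → ℂ) (j : ℕ) : matFun hB (fun x => f x ^ j) = matFun hB f ^ j := by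
  induction j with
  | zero => simpa using matFun_const hB 1
  | succ j ih => simp only [pow_succ, ← ih, matFun_mul]

lemma matFun_inv_sub {w : ℝ} (hw : ∀ i, hB.eigenvalues i ≠ w) :
    matFun hB (fun x => (((x - w)⁻¹ : ℝ) : ℂ)) = (B - (w : ℂ) • 1)⁻¹ := by
  refine (Matrix.inv_eq_right_inv ?_).symm
  have h : B - (w : ℂ) • 1 = matFun hB (fun x => (x : ℂ) - (w : ℂ)) := by
    rw [matFun_sub hB (fun x => (x : ℂ)), matFun_ofReal, matFun_const]
  rw [h, matFun_mul, ← one_smul ℂ (1 : Matrix (Fin m) (Fin m) ℂ), ← matFun_const hB]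
  refine matFun_congr hB fun i => ?_
  have : hB.eigenvalues i - w ≠ 0 := sub_ne_zero.mpr (hw i)
  rw [← Complex.ofReal_sub, ← Complex.ofReal_mul, mul_inv_cancel₀ this, Complex.ofReal_one]

lemma matFun_one_sub_div_pow (M : ℝ) (j : ℕ) :
    matFun hB (fun x => (((1 - x / M) ^ j : ℝ) : ℂ)) = (1 - (M : ℂ)⁻¹ • B) ^ j := by
  have h : matFun hB (fun x => (1 : ℂ) - (M : ℂ)⁻¹ * x) = 1 - (M : ℂ)⁻¹ • B := by
    rw [matFun_sub hB (fun _ => 1), matFun_const, matFun_const_mul, matFun_ofReal, one_smul]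
  rw [← h, ← matFun_pow]
  refine matFun_congr hB fun i => ?_
  push_cast
  rw [div_eq_inv_mul]

end MatFun

/-- Powers of a real matrix with checkerboard sign pattern have the same sign pattern. -/
lemma neg_one_pow_mul_pow_apply_nonneg {k : ℕ} {R : Matrix (Fin k) (Fin k) ℝ}
    (hR : ∀ i j : Fin k, 0 ≤ (-1) ^ (i + j : ℕ) * R i j) (m : ℕ) (i j : Fin k) :
    0 ≤ (-1) ^ (i + j : ℕ) * (R ^ m) i j := by
  induction m generalizing i j with
  | zero =>
    by_cases h : i = j
    · subst h; simp [← two_mul, pow_mul]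
    · simp [h]
  | succ m ih =>
    rw [pow_succ, Matrix.mul_apply, Finset.mul_sum]
    refine Finset.sum_nonneg fun l _ => ?_
    have h := mul_nonneg (ih i l) (hR l j)
    have hl : ((-1 : ℝ) ^ (l : ℕ)) * (-1) ^ (l : ℕ) = 1 := by simp [← mul_pow]
    convert h using 1
    rw [pow_add, pow_add, pow_add]
    linear_combination (-((-1) ^ (i : ℕ) * (-1) ^ (j : ℕ) * (R ^ m) i l * R l j)) * hl

/-- The eigenvalues of a compression `Qᴴ A Q` are bounded below by those of `A`. -/
lemma le_eigenvalues_of_compression {n k : ℕ} {A : Matrix (Fin n) (Fin n) ℂ}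
    (hA : A.IsHermitian) {Q : Matrix (Fin n) (Fin k) ℂ} (hQ : Qᴴ * Q = 1)
    {B : Matrix (Fin k) (Fin k) ℂ} (hB : B.IsHermitian) (hAB : Qᴴ * A * Q = B)
    {μ : ℝ} (hμ : ∀ i, μ ≤ hA.eigenvalues i) (l : Fin k) : μ ≤ hB.eigenvalues l := by
  have hpsd : (A - (μ : ℂ) • 1).PosSemidef := by
    have h : A - (μ : ℂ) • 1 = matFun hA (fun x => (x : ℂ) - (μ : ℂ)) := by
      rw [matFun_sub hA (fun x => (x : ℂ)), matFun_ofReal, matFun_const]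
    rw [h, matFun, star_eq_conjTranspose]
    refine PosSemidef.mul_mul_conjTranspose_same ?_ _
    refine posSemidef_diagonal_iff.mpr fun i => ?_
    rw [← Complex.ofReal_sub]
    exact Complex.zero_le_real.mpr (sub_nonneg.mpr (hμ i))
  have hc := hpsd.conjTranspose_mul_mul_same Q
  have hc' : Qᴴ * (A - (μ : ℂ) • 1) * Q = B - (μ : ℂ) • 1 := by
    rw [Matrix.mul_sub, Matrix.sub_mul, hAB, Matrix.mul_smul, Matrix.smul_mul, Matrix.mul_one, hQ]
  rw [hc'] at hc
  have hv : (B - (μ : ℂ) • 1) *ᵥ ⇑(hB.eigenvectorBasis l) =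
      ((hB.eigenvalues l - μ : ℝ) : ℂ) • ⇑(hB.eigenvectorBasis l) := by
    rw [sub_mulVec, hB.mulVec_eigenvectorBasis, smul_mulVec, one_mulVec]
    push_cast
    rw [sub_smul]
    rfl
  have hre := hc.re_dotProduct_nonneg ⇑(hB.eigenvectorBasis l)
  rw [hv, dotProduct_smul, dotProduct_comm, ← EuclideanSpace.inner_eq_star_dotProduct] at hre
  simpa using hre

section Coordinates

variable {n k : ℕ} {A : Matrix (Fin n) (Fin n) ℂ} (hA : A.IsHermitian)
  {B : Matrix (Fin k) (Fin k) ℂ} (hB : B.IsHermitian) (Q : Matrix (Fin n) (Fin k) ℂ)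
  (b : Fin n → ℂ)

/-- Coordinates of the error `f(A) b - Q f(B) Qᴴ b` in an eigenbasis of `A`. -/
noncomputable def eigenCoordError (f : ℝ → ℂ) : Fin n → ℂ :=
  (star (hA.eigenvectorUnitary : Matrix (Fin n) (Fin n) ℂ)).mulVec
    ((matFun hA f).mulVec b - (Q * matFun hB f * Qᴴ).mulVec b)

lemma eigenCoordError_apply (f : ℝ → ℂ) (i : Fin n) :
    eigenCoordError hA hB Q b f i =
      f (hA.eigenvalues i) *
        (star (hA.eigenvectorUnitary : Matrix (Fin n) (Fin n) ℂ)).mulVec b i -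
      ∑ l, f (hB.eigenvalues l) *
        ((star (hA.eigenvectorUnitary : Matrix (Fin n) (Fin n) ℂ) * Q *
            (hB.eigenvectorUnitary : Matrix (Fin k) (Fin k) ℂ)) i l *
          (star (hB.eigenvectorUnitary : Matrix (Fin k) (Fin k) ℂ)).mulVec (Qᴴ.mulVec b) l) := by
  rw [eigenCoordError, mulVec_sub, Pi.sub_apply, star_eigenvectorUnitary_mulVec_matFun]
  congr 1
  have h : (Q * matFun hB f * Qᴴ).mulVec b =
      (Q * (hB.eigenvectorUnitary : Matrix (Fin k) (Fin k) ℂ)).mulVec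
        ((diagonal fun l => f (hB.eigenvalues l)).mulVec
          ((star (hB.eigenvectorUnitary : Matrix (Fin k) (Fin k) ℂ)).mulVec (Qᴴ.mulVec b))) := by
    simp only [matFun, mulVec_mulVec, Matrix.mul_assoc]
  rw [h, mulVec_mulVec, ← Matrix.mul_assoc, mulVec, dotProduct]
  refine Finset.sum_congr rfl fun l _ => ?_
  rw [mulVec_diagonal]
  ring

lemma hasSum_eigenCoordError {f : ℝ → ℝ} {a : ℕ → ℝ} {g : ℕ → ℝ → ℝ} (i : Fin n)
    (hfA : HasSum (fun j => a j * g j (hA.eigenvalues i)) (f (hA.eigenvalues i)))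
    (hfB : ∀ l, HasSum (fun j => a j * g j (hB.eigenvalues l)) (f (hB.eigenvalues l))) :
    HasSum (fun j => (a j : ℂ) * eigenCoordError hA hB Q b (fun x => (g j x : ℂ)) i)
      (eigenCoordError hA hB Q b (fun x => (f x : ℂ)) i) := by
  simp only [eigenCoordError_apply]
  refine (((Complex.hasSum_ofReal.mpr hfA).mul_right _).sub
    (hasSum_sum fun l (_ : l ∈ Finset.univ) =>
      (Complex.hasSum_ofReal.mpr (hfB l)).mul_right _)).congr_fun fun j => ?_
  push_cast
  rw [mul_sub, Finset.mul_sum]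
  simp only [mul_assoc]

lemma norm2_eigenCoordError (f : ℝ → ℂ) :
    norm2 (eigenCoordError hA hB Q b f) =
      norm2 ((matFun hA f).mulVec b - (Q * matFun hB f * Qᴴ).mulVec b) :=
  norm2_star_unitary_mulVec _ _

end Coordinates

/-- One step of the recurrence for the errors `S ^ j b - Q R ^ j Qᴴ b` of monomials. -/
lemma lanczos_pow_error_succ {n k : ℕ} {S : Matrix (Fin n) (Fin n) ℂ}
    {Q : Matrix (Fin n) (Fin k) ℂ} {R : Matrix (Fin k) (Fin k) ℂ} {b q : Fin n → ℂ} {γ ν : ℂ}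
    {r z : Fin k} (hSQ : S * Q = Q * R + γ • vecMulVec q (Pi.single r 1))
    (hb : Qᴴ.mulVec b = ν • Pi.single z 1) (j : ℕ) :
    (S ^ (j + 1)).mulVec b - (Q * R ^ (j + 1) * Qᴴ).mulVec b =
      S.mulVec ((S ^ j).mulVec b - (Q * R ^ j * Qᴴ).mulVec b) +
        (γ * ν * (R ^ j) r z) • q := by
  have h : S.mulVec ((Q * R ^ j * Qᴴ).mulVec b) =
      (Q * R ^ (j + 1) * Qᴴ).mulVec b + (γ * ν * (R ^ j) r z) • q := by
    have h1 : S * (Q * R ^ j * Qᴴ) =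
        Q * R ^ (j + 1) * Qᴴ + γ • (vecMulVec q (Pi.single r 1) * R ^ j * Qᴴ) := by
      rw [← Matrix.mul_assoc, ← Matrix.mul_assoc, hSQ, Matrix.add_mul, Matrix.add_mul, pow_succ',
        Matrix.mul_assoc Q R, Matrix.smul_mul, Matrix.smul_mul]
    rw [mulVec_mulVec, h1, add_mulVec, smul_mulVec]
    congr 1
    rw [← mulVec_mulVec, ← mulVec_mulVec, hb, mulVec_smul, mulVec_smul, vecMulVec_mulVec]
    ext i
    simp
    ring
  rw [mulVec_sub, h, mulVec_mulVec, ← pow_succ']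
  abel

lemma eq_norm2_smul_of_eq_inv_smul {n : ℕ} {b v : Fin n → ℂ} (hb : b ≠ 0)
    (h : v = (norm2 b)⁻¹ • b) : b = (norm2 b : ℂ) • v := by
  have := (norm2_pos hb).ne'
  rw [h, Complex.coe_smul, smul_smul, mul_inv_cancel₀ this, one_smul]

/-- Sign pattern of `1 - T / M` for a Jacobi matrix `T` whose diagonal is at most `M`. -/
lemma checkerboard_one_sub_smul {k : ℕ} {T : Matrix (Fin k) (Fin k) ℝ} (hTsymm : T.IsSymm)
    (hTtri : ∀ i j : Fin k, (i : ℕ) + 1 < (j : ℕ) ∨ (j : ℕ) + 1 < (i : ℕ) → T i j = 0)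
    (hToff : ∀ i j : Fin k, (i : ℕ) + 1 = (j : ℕ) → 0 < T i j) {M : ℝ} (hM : 0 < M)
    (hdiag : ∀ i, T i i ≤ M) (i j : Fin k) :
    0 ≤ (-1) ^ (i + j : ℕ) * (1 - M⁻¹ • T) i j := by
  have hM' : 0 ≤ M⁻¹ := by positivity
  rcases eq_or_ne i j with rfl | hij
  · have : M⁻¹ * T i i ≤ 1 := by
      rw [← div_eq_inv_mul]
      exact (div_le_one hM).mpr (hdiag i)
    simpa [← two_mul, pow_mul] using this
  have hval : (1 - M⁻¹ • T) i j = -(M⁻¹ * T i j) := by simp [hij]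
  have hij' : (i : ℕ) ≠ j := fun h => hij (Fin.ext h)
  rw [hval]
  rcases lt_trichotomy ((i : ℕ) + 1) j with h | h | h
  · simp [hTtri i j (Or.inl h)]
  · have := mul_nonneg hM' (hToff i j h).le
    rw [← h, ← add_assoc, ← two_mul, pow_succ, pow_mul]
    simpa using this
  · rcases lt_trichotomy ((j : ℕ) + 1) i with h' | h' | h'
    · simp [hTtri i j (Or.inr h')]
    · have h1 := hToff j i h'
      rw [hTsymm.apply] at h1
      have := mul_nonneg hM' h1.le
      rw [← h', add_right_comm, ← two_mul, pow_succ, pow_mul]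
      simpa using this
    · omega

/-- In an eigendirection of `A`, the Lanczos-FA errors for the monomials `(1 - x / M) ^ j` solve a
first-order linear recurrence with a forcing term of constant sign. -/
lemma exists_eigenCoordError_recurrence {n k : ℕ} {A : Matrix (Fin n) (Fin n) ℂ}
    (hA : A.IsHermitian) {b : Fin n → ℂ} {Q : Matrix (Fin n) (Fin k) ℂ} (hQ : Qᴴ * Q = 1)
    {z r : Fin k} {ν β : ℂ} (hb : b = ν • Q.mulVec (Pi.single z 1))
    {T : Matrix (Fin k) (Fin k) ℝ} (hTsymm : T.IsSymm)
    (hTtri : ∀ i j : Fin k, (i : ℕ) + 1 < (j : ℕ) ∨ (j : ℕ) + 1 < (i : ℕ) → T i j = 0)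
    (hToff : ∀ i j : Fin k, (i : ℕ) + 1 = (j : ℕ) → 0 < T i j) {q : Fin n → ℂ}
    (hAQ : A * Q = Q * T.map Complex.ofReal + β • vecMulVec q (Pi.single r 1))
    (hTH : (T.map Complex.ofReal).IsHermitian) {M : ℝ} (hM : 0 < M) (hMT : ∀ l, T l l ≤ M)
    (i : Fin n) {d : ℕ → ℂ}
    (hd : ∀ j, d j = eigenCoordError hA hTH Q b (fun x => (((1 - x / M) ^ j : ℝ) : ℂ)) i) :
    ∃ (φ : ℕ → ℝ) (κ : ℂ), (∀ j, 0 ≤ φ j) ∧ d 0 = 0 ∧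
      ∀ j, d (j + 1) = ((1 - hA.eigenvalues i / M : ℝ) : ℂ) * d j + φ j * κ := by
  have hd_eq : ∀ j, d j = (star (hA.eigenvectorUnitary : Matrix (Fin n) (Fin n) ℂ)).mulVec
      (((1 - (M : ℂ)⁻¹ • A) ^ j).mulVec b -
        (Q * (1 - (M : ℂ)⁻¹ • T.map Complex.ofReal) ^ j * Qᴴ).mulVec b) i := by
    intro j
    rw [hd, eigenCoordError, matFun_one_sub_div_pow, matFun_one_sub_div_pow]
  have hQb : Qᴴ.mulVec b = ν • Pi.single z 1 := by
    rw [hb, mulVec_smul, mulVec_mulVec, hQ, one_mulVec]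
  have hSQ : (1 - (M : ℂ)⁻¹ • A) * Q = Q * (1 - (M : ℂ)⁻¹ • T.map Complex.ofReal) +
      (-(M : ℂ)⁻¹ * β) • vecMulVec q (Pi.single r 1) := by
    rw [Matrix.sub_mul, Matrix.mul_sub, Matrix.smul_mul, Matrix.mul_smul, hAQ, Matrix.one_mul,
      Matrix.mul_one, smul_add, smul_smul, neg_mul, neg_smul]
    abel
  have hRmap : ∀ j, ((1 - (M : ℂ)⁻¹ • T.map Complex.ofReal) ^ j : Matrix (Fin k) (Fin k) ℂ) r z =
      (((1 - M⁻¹ • T) ^ j : Matrix (Fin k) (Fin k) ℝ) r z : ℂ) := by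
    intro j
    have h : 1 - (M : ℂ)⁻¹ • T.map Complex.ofReal =
        Complex.ofRealHom.mapMatrix (1 - M⁻¹ • T) := by
      ext a c
      simp [Matrix.one_apply, apply_ite Complex.ofReal]
    rw [h, ← map_pow]
    rfl
  refine ⟨fun j => (-1) ^ (r + z : ℕ) * ((1 - M⁻¹ • T) ^ j : Matrix (Fin k) (Fin k) ℝ) r z,
    -(M : ℂ)⁻¹ * β * ν * (-1) ^ (r + z : ℕ) *
      (star (hA.eigenvectorUnitary : Matrix (Fin n) (Fin n) ℂ)).mulVec q i,
    fun j => neg_one_pow_mul_pow_apply_nonneg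
      (checkerboard_one_sub_smul hTsymm hTtri hToff hM hMT) j r z, ?_, fun j => ?_⟩
  · have h : (Q * Qᴴ).mulVec b = b := by
      rw [← mulVec_mulVec, hQb, mulVec_smul, ← hb]
    rw [hd_eq, pow_zero, pow_zero, one_mulVec, Matrix.mul_one, h, sub_self, mulVec_zero,
      Pi.zero_apply]
  · have h := star_eigenvectorUnitary_mulVec_matFun hA
      (fun x => (((1 - x / M) ^ 1 : ℝ) : ℂ)) (((1 - (M : ℂ)⁻¹ • A) ^ j).mulVec b -
        (Q * (1 - (M : ℂ)⁻¹ • T.map Complex.ofReal) ^ j * Qᴴ).mulVec b) i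
    rw [matFun_one_sub_div_pow, pow_one, pow_one, ← hd_eq] at h
    rw [hd_eq, lanczos_pow_error_succ hSQ hQb, mulVec_add, Pi.add_apply, h, mulVec_smul,
      Pi.smul_apply, hRmap, smul_eq_mul]
    have hsq : ((-1 : ℂ) ^ (r + z : ℕ)) * (-1) ^ (r + z : ℕ) = 1 := by simp [← mul_pow]
    beta_reduce
    generalize ((1 - M⁻¹ • T) ^ j : Matrix (Fin k) (Fin k) ℝ) r z = ρ
    generalize (star (hA.eigenvectorUnitary : Matrix (Fin n) (Fin n) ℂ)).mulVec q i = η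
    push_cast
    linear_combination ((M : ℂ)⁻¹ * β * ν * ρ * η) * hsq

/-- In every eigendirection of `A`, the Lanczos-FA error for `x ^ (-p)` is controlled by the
Lanczos-FA error for the shifted inverse `(x - w)⁻¹`. -/
lemma norm_eigenCoordError_rpow_neg_le {n k : ℕ} {A : Matrix (Fin n) (Fin n) ℂ}
    (hA : A.IsHermitian) {b : Fin n → ℂ} {Q : Matrix (Fin n) (Fin k) ℂ} (hQ : Qᴴ * Q = 1)
    {z r : Fin k} {ν β : ℂ} (hb : b = ν • Q.mulVec (Pi.single z 1))
    {T : Matrix (Fin k) (Fin k) ℝ} (hTsymm : T.IsSymm)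
    (hTtri : ∀ i j : Fin k, (i : ℕ) + 1 < (j : ℕ) ∨ (j : ℕ) + 1 < (i : ℕ) → T i j = 0)
    (hToff : ∀ i j : Fin k, (i : ℕ) + 1 = (j : ℕ) → 0 < T i j) {q : Fin n → ℂ}
    (hAQ : A * Q = Q * T.map Complex.ofReal + β • vecMulVec q (Pi.single r 1))
    (hTH : (T.map Complex.ofReal).IsHermitian) {p w : ℝ} (hp : 0 < p) (hw : 0 < w)
    (i : Fin n) (hwA : w < hA.eigenvalues i) (hwT : ∀ l, w < hTH.eigenvalues l) :
    ‖eigenCoordError hA hTH Q b (fun x => ((x ^ (-p) : ℝ) : ℂ)) i‖ ≤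
      w ^ (-p) * ((hA.eigenvalues i - w) *
        ‖eigenCoordError hA hTH Q b (fun x => (((x - w)⁻¹ : ℝ) : ℂ)) i‖) := by
  obtain ⟨M, hMA, hMB, hMT⟩ : ∃ M : ℝ, hA.eigenvalues i ≤ M ∧
      (∀ l, hTH.eigenvalues l ≤ M) ∧ ∀ l, T l l ≤ M := by
    obtain ⟨M, hM⟩ := ((((Set.finite_singleton (hA.eigenvalues i)).union
      (Set.finite_range hTH.eigenvalues)).union (Set.finite_range fun l => T l l))).bddAbove
    exact ⟨M, hM (by simp), fun l => hM (by simp), fun l => hM (by simp)⟩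
  have hMw : w < M := hwA.trans_le hMA
  have hM : 0 < M := hw.trans hMw
  obtain ⟨φ, κ, hφ, hd0, hds⟩ := exists_eigenCoordError_recurrence hA hQ hb hTsymm hTtri hToff
    hAQ hTH hM hMT i (d := fun j =>
      eigenCoordError hA hTH Q b (fun x => (((1 - x / M) ^ j : ℝ) : ℂ)) i) (fun _ => rfl)
  have hX := hasSum_eigenCoordError hA hTH Q b (f := fun x => x ^ (-p))
    (a := fun j => M ^ (-p) * Ring.choose (p + j - 1) j) (g := fun j x => (1 - x / M) ^ j) i
    (hasSum_rpow_neg hM (hw.trans hwA) hMA)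
    (fun l => hasSum_rpow_neg hM (hw.trans (hwT l)) (hMB l))
  have hY := (hasSum_eigenCoordError hA hTH Q b (f := fun x => (x - w)⁻¹)
    (a := fun j => M⁻¹ * (1 - w / M)⁻¹ ^ (j + 1)) (g := fun j x => (1 - x / M) ^ j) i
    (hasSum_inv_sub hM hwA hMA) (fun l => hasSum_inv_sub hM (hwT l) (hMB l))).mul_left (M : ℂ)
  have hMc : (M : ℂ) ≠ 0 := by exact_mod_cast hM.ne'
  simp only [Complex.ofReal_mul M⁻¹, Complex.ofReal_inv M, mul_assoc, mul_inv_cancel_left₀ hMc]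
    at hY
  have key := norm_le_of_linear_recurrence hφ
    (sub_nonneg.mpr ((div_le_one hM).mpr hMA))
    (sub_lt_sub_left (div_lt_div_of_pos_right hwA hM) 1) hd0 hds
    (fun j => mul_nonneg (Real.rpow_nonneg hM.le _) (choose_add_sub_one_nonneg hp j))
    (hasSum_rpow_neg hM hw hMw.le) hX hY
  refine key.trans_eq ?_
  rw [norm_mul, Complex.norm_real, Real.norm_of_nonneg hM.le]
  field_simp
  ring

lemma mul_norm2_le_norm2_matFun_mulVec {m : ℕ} {B : Matrix (Fin m) (Fin m) ℂ}
    (hB : B.IsHermitian) {f : ℝ → ℂ} {C : ℝ} (hC : 0 < C)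
    (hf : ∀ i, C ≤ ‖f (hB.eigenvalues i)‖) (v : Fin m → ℂ) :
    C * norm2 v ≤ norm2 ((matFun hB f).mulVec v) := by
  rw [← norm2_star_unitary_mulVec hB.eigenvectorUnitary v,
    ← norm2_star_unitary_mulVec hB.eigenvectorUnitary ((matFun hB f).mulVec v),
    ← le_inv_mul_iff₀ hC]
  refine norm2_le_mul_of_forall_norm_le (by positivity) fun i => ?_
  rw [le_inv_mul_iff₀ hC, star_eigenvectorUnitary_mulVec_matFun, norm_mul]
  gcongr
  exact hf i

lemma norm2_matFun_mulVec_le {m : ℕ} {B : Matrix (Fin m) (Fin m) ℂ}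
    (hB : B.IsHermitian) {f : ℝ → ℂ} {C : ℝ} (hC : 0 ≤ C)
    (hf : ∀ i, ‖f (hB.eigenvalues i)‖ ≤ C) (v : Fin m → ℂ) :
    norm2 ((matFun hB f).mulVec v) ≤ C * norm2 v := by
  rw [← norm2_star_unitary_mulVec hB.eigenvectorUnitary v,
    ← norm2_star_unitary_mulVec hB.eigenvectorUnitary ((matFun hB f).mulVec v)]
  refine norm2_le_mul_of_forall_norm_le hC fun i => ?_
  rw [star_eigenvectorUnitary_mulVec_matFun, norm_mul]
  gcongr
  exact hf i

theorem lanczos_fa_inverse_power_relative_bound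
    {n k : ℕ} (hn : 0 < n) (hk : 0 < k)
    (A : Matrix (Fin n) (Fin n) ℂ) (hA : A.IsHermitian)
    (b : Fin n → ℂ) (hb : b ≠ 0)
    (Q : Matrix (Fin n) (Fin k) ℂ) (hQ : Qᴴ * Q = 1)
    (hQb : Q.mulVec (Pi.single (⟨0, hk⟩ : Fin k) 1) = (norm2 b)⁻¹ • b)
    (T : Matrix (Fin k) (Fin k) ℝ) (hTsymm : T.IsSymm)
    (hTtri : ∀ i j : Fin k, (i : ℕ) + 1 < (j : ℕ) ∨ (j : ℕ) + 1 < (i : ℕ) → T i j = 0)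
    (hToff : ∀ i j : Fin k, (i : ℕ) + 1 = (j : ℕ) → 0 < T i j)
    (βk : ℝ) (hβk : 0 < βk)
    (q : Fin n → ℂ) (hq : norm2 q = 1) (hQq : Qᴴ.mulVec q = 0)
    (hAQ : A * Q = Q * T.map Complex.ofReal + (βk : ℂ) •
      Matrix.vecMulVec q (Pi.single (⟨k - 1, Nat.sub_lt hk Nat.one_pos⟩ : Fin k) 1))
    (hApd : A.PosDef) (hTH : (T.map Complex.ofReal).IsHermitian)
    (qe : ℝ) (hqe : 1 ≤ qe) (c : ℝ) (hc : c ∈ Set.Ioo (0 : ℝ) 1) :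
    norm2 ((matFun hA fun x : ℝ => ((x ^ (-qe) : ℝ) : ℂ)).mulVec b -
          (Q * matFun hTH (fun x : ℝ => ((x ^ (-qe) : ℝ) : ℂ)) * Qᴴ).mulVec b) /
        norm2 ((matFun hA fun x : ℝ => ((x ^ (-qe) : ℝ) : ℂ)).mulVec b) ≤
      c ^ (-qe) * ((⨆ i, hA.eigenvalues i) / (⨅ i, hA.eigenvalues i)) ^ qe *
        (((⨆ i, hA.eigenvalues i) - c * ⨅ i, hA.eigenvalues i) /
          ((⨅ i, hA.eigenvalues i) - c * ⨅ i, hA.eigenvalues i)) *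
        (norm2 (errK A Q (T.map Complex.ofReal) b ((c * ⨅ i, hA.eigenvalues i : ℝ) : ℂ)) /
          norm2 ((A - ((c * ⨅ i, hA.eigenvalues i : ℝ) : ℂ) • 1)⁻¹.mulVec b)) := by
  have : Nonempty (Fin n) := ⟨⟨0, hn⟩⟩
  set lo : ℝ := ⨅ i, hA.eigenvalues i with hlo_def
  set hi : ℝ := ⨆ i, hA.eigenvalues i with hhi_def
  have hlo : ∀ i, lo ≤ hA.eigenvalues i := ciInf_le (Set.finite_range _).bddBelow
  have hhi : ∀ i, hA.eigenvalues i ≤ hi := le_ciSup (Set.finite_range _).bddAbove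
  have hlo_pos : 0 < lo := by
    obtain ⟨i, hi'⟩ := exists_eq_ciInf_of_finite (f := hA.eigenvalues)
    rw [hlo_def, ← hi']
    exact hApd.eigenvalues_pos i
  have hlohi : lo ≤ hi := (hlo ⟨0, hn⟩).trans (hhi ⟨0, hn⟩)
  have hhi_pos : 0 < hi := hlo_pos.trans_le hlohi
  have hw : 0 < c * lo := mul_pos hc.1 hlo_pos
  have hwlo : c * lo < lo := mul_lt_of_lt_one_left hlo_pos hc.2
  have hqe0 : 0 < qe := one_pos.trans_le hqe
  have hcompr : Qᴴ * A * Q = T.map Complex.ofReal := by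
    rw [Matrix.mul_assoc, hAQ, Matrix.mul_add, ← Matrix.mul_assoc, hQ, Matrix.one_mul,
      Matrix.mul_smul, mul_vecMulVec, hQq]
    simp
  have hwA : ∀ i, c * lo < hA.eigenvalues i := fun i => hwlo.trans_le (hlo i)
  have hwT : ∀ l, c * lo < hTH.eigenvalues l := fun l =>
    hwlo.trans_le (le_eigenvalues_of_compression hA hQ hTH hcompr hlo l)
  have hinvA := matFun_inv_sub hA (fun i => (hwA i).ne')
  have hinvT := matFun_inv_sub hTH (fun l => (hwT l).ne')
  have hnb : 0 < norm2 b := norm2_pos hb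
  have hrpow : 0 < (c * lo) ^ (-qe) := Real.rpow_pos_of_pos hw _
  have hgap : 0 < lo - c * lo := sub_pos.mpr hwlo
  have herr : norm2 ((matFun hA fun x : ℝ => ((x ^ (-qe) : ℝ) : ℂ)).mulVec b -
      (Q * matFun hTH (fun x : ℝ => ((x ^ (-qe) : ℝ) : ℂ)) * Qᴴ).mulVec b) ≤
      (c * lo) ^ (-qe) * (hi - c * lo) *
        norm2 (errK A Q (T.map Complex.ofReal) b ((c * lo : ℝ) : ℂ)) := by
    rw [errK, ← hinvA, ← hinvT, ← norm2_eigenCoordError, ← norm2_eigenCoordError]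
    refine norm2_le_mul_of_forall_norm_le (by nlinarith) fun i => ?_
    refine (norm_eigenCoordError_rpow_neg_le hA hQ (eq_norm2_smul_of_eq_inv_smul hb hQb) hTsymm hTtri
      hToff hAQ hTH hqe0 hw i (hwA i) hwT).trans ?_
    rw [mul_assoc]
    gcongr
    exact hhi i
  have hden : hi ^ (-qe) * norm2 b ≤
      norm2 ((matFun hA fun x : ℝ => ((x ^ (-qe) : ℝ) : ℂ)).mulVec b) := by
    refine mul_norm2_le_norm2_matFun_mulVec hA (Real.rpow_pos_of_pos hhi_pos _) (fun i => ?_) b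
    have hpos : 0 < hA.eigenvalues i := hlo_pos.trans_le (hlo i)
    rw [Complex.norm_real, Real.norm_of_nonneg (Real.rpow_nonneg hpos.le _)]
    exact Real.rpow_le_rpow_of_nonpos hpos (hhi i) (by linarith)
  have herr0_le : norm2 ((A - ((c * lo : ℝ) : ℂ) • 1)⁻¹.mulVec b) ≤
      (lo - c * lo)⁻¹ * norm2 b := by
    rw [← hinvA]
    refine norm2_matFun_mulVec_le hA (by positivity) (fun i => ?_) b
    have hpos : 0 < hA.eigenvalues i - c * lo := sub_pos.mpr (hwA i)
    rw [Complex.norm_real, Real.norm_of_nonneg (by positivity)]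
    gcongr
    exact hlo i
  have herr0_pos : 0 < norm2 ((A - ((c * lo : ℝ) : ℂ) • 1)⁻¹.mulVec b) := by
    have hgap' : 0 < hi - c * lo := hgap.trans_le (by linarith)
    refine lt_of_lt_of_le (mul_pos (inv_pos.mpr hgap') hnb) ?_
    rw [← hinvA]
    refine mul_norm2_le_norm2_matFun_mulVec hA (inv_pos.mpr hgap') (fun i => ?_) b
    have hpos : 0 < hA.eigenvalues i - c * lo := sub_pos.mpr (hwA i)
    rw [Complex.norm_real, Real.norm_of_nonneg (by positivity)]
    gcongr
    exact hhi i
  have hhir : 0 < hi ^ (-qe) := Real.rpow_pos_of_pos hhi_pos _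
  have hE := norm2_nonneg (errK A Q (T.map Complex.ofReal) b ((c * lo : ℝ) : ℂ))
  have hgap' : 0 ≤ hi - c * lo := by linarith
  calc _ ≤ (c * lo) ^ (-qe) * (hi - c * lo) *
          norm2 (errK A Q (T.map Complex.ofReal) b ((c * lo : ℝ) : ℂ)) /
          (hi ^ (-qe) * norm2 b) := by gcongr
    _ = c ^ (-qe) * (hi / lo) ^ qe * ((hi - c * lo) / (lo - c * lo)) *
          (norm2 (errK A Q (T.map Complex.ofReal) b ((c * lo : ℝ) : ℂ)) /
            ((lo - c * lo)⁻¹ * norm2 b)) := by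
        rw [Real.mul_rpow hc.1.le hlo_pos.le, Real.div_rpow hhi_pos.le hlo_pos.le,
          Real.rpow_neg hlo_pos.le, Real.rpow_neg hhi_pos.le]
        have hc1 : 1 - c ≠ 0 := (sub_pos.mpr hc.2).ne'
        have := Real.rpow_pos_of_pos hhi_pos qe
        have := Real.rpow_pos_of_pos hlo_pos qe
        field_simp
    _ ≤ _ := by
        have := Real.rpow_nonneg hc.1.le (-qe)
        gcongr
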